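/- arXiv:1808.07600 — 2 statements merged into one kernel-verified Lean document; each statement's English description precedes it below -/
import Mathlib

section
/- Let p be an integer-valued supermodular set-function on the subsets of a nonempty finite set S with p(∅) = 0, assume Ḃ(p) is nonempty, and suppose the peak set S₁ is a proper subset of S. Then a vector m : S → ℤ is a decreasingly minimal element of Ḃ(p) if and only if the restriction of m to S₁ is a decreasingly minimal element of Ḃ(p₁) and the restriction of m to S ∖ S₁ is a decreasingly minimal element of Ḃ(p₁′). -/
open Finset

variable {α : Type*}

/-- Integer-valued supermodular set-function. -/
def Supermodular [DecidableEq α] (p : Finset α → ℤ) : Prop :=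
  ∀ X Y : Finset α, p X + p Y ≤ p (X ∩ Y) + p (X ∪ Y)

/-- The M-convex set `Ḃ(p)` of integral elements of the base-polyhedron `B'(p)`:
all `m : α → ℤ` with `m̃(X) ≥ p(X)` for every `X` and `m̃(S) = p(S)`. -/
def Bdot [Fintype α] (p : Finset α → ℤ) : Set (α → ℤ) :=
  {m | (∀ X : Finset α, p X ≤ ∑ s ∈ X, m s) ∧ (∑ s, m s) = p Finset.univ}

/-- `x↓`: the values of `x` arranged in nonincreasing order. -/
def sortedDesc [Fintype α] (x : α → ℤ) : List ℤ :=
  ((Finset.univ.val.map x).sort (· ≤ ·)).reverse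

/-- `x↑`: the values of `x` arranged in nondecreasing order. -/
def sortedAsc [Fintype α] (x : α → ℤ) : List ℤ :=
  (Finset.univ.val.map x).sort (· ≤ ·)

/-- `x ≤_dec y`: `x↓` is lexicographically less than or equal to `y↓`. -/
def DecLE [Fintype α] (x y : α → ℤ) : Prop :=
  sortedDesc x = sortedDesc y ∨ List.Lex (· < ·) (sortedDesc x) (sortedDesc y)

/-- `x ≤_inc y`: `x↑` is lexicographically less than or equal to `y↑`. -/
def IncLE [Fintype α] (x y : α → ℤ) : Prop :=
  sortedAsc x = sortedAsc y ∨ List.Lex (· < ·) (sortedAsc x) (sortedAsc y)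

/-- `m` is a decreasingly minimal element of `Bdot p`. -/
def DecMin [Fintype α] (p : Finset α → ℤ) (m : α → ℤ) : Prop :=
  m ∈ Bdot p ∧ ∀ y ∈ Bdot p, DecLE m y

/-- Exponential potential. -/
def Phi [Fintype α] (K : ℚ) (x : α → ℤ) : ℚ := ∑ s, K ^ (x s)

lemma lex_pot (K : ℚ) (hK : 1 < K) : ∀ l l' : List ℤ, List.Lex (· < ·) l l' →
    l.length = l'.length → (l.length : ℚ) < K → l.Pairwise (· ≥ ·) →
    (l.map (fun v => K ^ v)).sum < (l'.map (fun v => K ^ v)).sum := by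
  intro l l' h
  have K0 : 0 < K := by linarith
  induction h with
  | nil => intro h; simp at h
  | @cons a l l' h ih =>
    intro h1 h2 h3
    simp only [List.length_cons, List.map_cons, List.sum_cons] at *
    push_cast at h2
    have := ih (by omega) (by linarith) (List.pairwise_cons.1 h3).2
    linarith
  | @rel a l b l' h =>
    intro h1 h2 h3
    have hle : ∀ v ∈ (a :: l).map (fun v => K ^ v), v ≤ K ^ a := by
      intro v hv
      obtain ⟨w, hw, rfl⟩ := List.mem_map.1 hv
      refine zpow_le_zpow_right₀ hK.le ?_
      rcases List.mem_cons.1 hw with rfl | hw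
      · exact le_rfl
      · exact (List.pairwise_cons.1 h3).1 w hw
    have e1 := List.sum_le_card_nsmul _ _ hle
    rw [List.length_map, nsmul_eq_mul] at e1
    have hp : 0 < K ^ a := zpow_pos K0 a
    have e2 : ((a :: l).length : ℚ) * K ^ a < K * K ^ a := by
      exact mul_lt_mul_of_pos_right h2 hp
    have e3 : K * K ^ a ≤ K ^ b := by
      rw [← zpow_one_add₀ K0.ne']
      exact zpow_le_zpow_right₀ hK.le (by omega)
    have e4 : 0 ≤ (l'.map (fun v => K ^ v)).sum := by
      apply List.sum_nonneg
      intro v hv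
      obtain ⟨w, hw, rfl⟩ := List.mem_map.1 hv
      exact (zpow_pos K0 w).le
    rw [List.map_cons (l := l'), List.sum_cons (l := l'.map _)]
    linarith

lemma sum_sortedDesc [Fintype α] (K : ℚ) (x : α → ℤ) :
    ((sortedDesc x).map (fun v => K ^ v)).sum = Phi K x := by
  unfold sortedDesc Phi
  rw [List.map_reverse, List.sum_reverse, ← Multiset.sum_coe, ← Multiset.map_coe,
    Multiset.sort_eq, Multiset.map_map]
  rfl

lemma length_sortedDesc [Fintype α] (x : α → ℤ) :
    (sortedDesc x).length = Fintype.card α := by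
  simp [sortedDesc]

lemma pairwise_sortedDesc [Fintype α] (x : α → ℤ) :
    (sortedDesc x).Pairwise (· ≥ ·) := by
  unfold sortedDesc
  rw [List.pairwise_reverse]
  exact Multiset.pairwise_sort _ _

lemma decLE_iff [Fintype α] (K : ℚ) (hK : 1 < K) (hc : (Fintype.card α : ℚ) < K)
    (x y : α → ℤ) : DecLE x y ↔ Phi K x ≤ Phi K y := by
  have key : ∀ x y : α → ℤ, List.Lex (· < ·) (sortedDesc x) (sortedDesc y) →
      Phi K x < Phi K y := by
    intro x y h
    have := lex_pot K hK _ _ h (by simp [length_sortedDesc])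
      (by rw [length_sortedDesc]; exact hc) (pairwise_sortedDesc x)
    simpa only [sum_sortedDesc] using this
  constructor
  · rintro (h | h)
    · rw [← sum_sortedDesc, ← sum_sortedDesc, h]
    · exact (key x y h).le
  · intro h
    rcases lt_trichotomy (sortedDesc x) (sortedDesc y) with h1 | h1 | h1
    · exact Or.inr h1
    · exact Or.inl h1
    · exact absurd (key y x h1) (not_lt.2 h)

lemma sum_split_sub [Fintype α] [DecidableEq α] {M : Type*} [AddCommMonoid M] (S₁ : Finset α)
    (f : α → M) : (∑ x : {a : α // a ∈ S₁}, f x.val) + (∑ x : {a : α // a ∉ S₁}, f x.val)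
      = ∑ x, f x := by
  convert Fintype.sum_subtype_add_sum_subtype (fun a => a ∈ S₁) f

lemma phi_split [Fintype α] [DecidableEq α] (K : ℚ) (S₁ : Finset α) (m : α → ℤ) :
    Phi K m = Phi K (fun x : {a : α // a ∈ S₁} => m x.val) +
      Phi K (fun x : {a : α // a ∉ S₁} => m x.val) := by
  unfold Phi
  exact (sum_split_sub S₁ (fun a => K ^ m a)).symm

lemma bdot_restrict [Fintype α] [DecidableEq α] (p : Finset α → ℤ) (S₁ : Finset α) (m : α → ℤ)
    (hm : m ∈ Bdot p) (ht : ∑ s ∈ S₁, m s = p S₁) :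
    (fun x : {a : α // a ∈ S₁} => m x.val) ∈ Bdot (fun X : Finset {a : α // a ∈ S₁} =>
          p (X.map (Function.Embedding.subtype (· ∈ S₁)))) ∧
    (fun x : {a : α // a ∉ S₁} => m x.val) ∈ Bdot (fun X : Finset {a : α // a ∉ S₁} =>
          p ((X.map (Function.Embedding.subtype (· ∉ S₁))) ∪ S₁) - p S₁) := by
  have hU : (univ : Finset {a : α // a ∈ S₁}).map (Function.Embedding.subtype (· ∈ S₁)) = S₁ := by
    ext a; simp
  have hV : (univ : Finset {a : α // a ∉ S₁}).map (Function.Embedding.subtype (· ∉ S₁)) ∪ S₁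
      = univ := by
    ext a; simp; tauto
  have hd : ∀ X : Finset {a : α // a ∉ S₁},
      ∑ s ∈ X.map (Function.Embedding.subtype (· ∉ S₁)) ∪ S₁, m s =
        ∑ s ∈ X, m s.val + p S₁ := by
    intro X
    rw [Finset.sum_union, ht, Finset.sum_map]
    · rfl
    · rw [Finset.disjoint_left]; intro a; simp; tauto
  refine ⟨⟨fun X => ?_, ?_⟩, ⟨fun X => ?_, ?_⟩⟩
  · have := hm.1 (X.map (Function.Embedding.subtype (· ∈ S₁)))
    rwa [Finset.sum_map] at this
  · show _ = p _
    rw [hU, ← ht]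
    conv_rhs => rw [← hU, Finset.sum_map]
    rfl
  · have := hm.1 (X.map (Function.Embedding.subtype (· ∉ S₁)) ∪ S₁)
    rw [hd] at this
    show p _ - _ ≤ _
    linarith
  · have := hd univ
    show _ = p _ - _
    rw [hV, hm.2] at this
    rw [hV]
    linarith

lemma bdot_glue [Fintype α] [DecidableEq α] (p : Finset α → ℤ) (hp : Supermodular p)
    (S₁ : Finset α) (m : α → ℤ)
    (h1 : (fun x : {a : α // a ∈ S₁} => m x.val) ∈ Bdot (fun X : Finset {a : α // a ∈ S₁} =>
          p (X.map (Function.Embedding.subtype (· ∈ S₁)))))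
    (h2 : (fun x : {a : α // a ∉ S₁} => m x.val) ∈ Bdot (fun X : Finset {a : α // a ∉ S₁} =>
          p ((X.map (Function.Embedding.subtype (· ∉ S₁))) ∪ S₁) - p S₁)) :
    m ∈ Bdot p := by
  have hU : (univ : Finset {a : α // a ∈ S₁}).map (Function.Embedding.subtype (· ∈ S₁)) = S₁ := by
    ext a; simp
  have hV : (univ : Finset {a : α // a ∉ S₁}).map (Function.Embedding.subtype (· ∉ S₁)) ∪ S₁
      = univ := by
    ext a; simp; tauto
  refine ⟨fun X => ?_, ?_⟩
  · have e1 := h1.1 (X.subtype (· ∈ S₁))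
    have e2 := h2.1 (X.subtype (· ∉ S₁))
    simp only [Finset.subtype_map] at e1 e2
    rw [Finset.sum_subtype_eq_sum_filter] at e1 e2
    have e3 := hp X S₁
    have e4 : X.filter (· ∈ S₁) = X ∩ S₁ := by ext; simp
    have e5 : X.filter (· ∉ S₁) ∪ S₁ = X ∪ S₁ := by ext; simp; tauto
    rw [e5] at e2
    rw [← Finset.sum_filter_add_sum_filter_not X (· ∈ S₁)]
    rw [e4] at e1 ⊢
    linarith
  · have e1 := h1.2
    have e2 := h2.2
    simp only [hU, hV] at e1 e2
    have := sum_split_sub S₁ (fun a => m a)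
    linarith

lemma bdot_finite [Fintype α] [DecidableEq α] (p : Finset α → ℤ) : (Bdot p).Finite := by
  apply (Set.finite_Icc (fun s => p {s}) (fun s => p univ - p (univ.erase s))).subset
  intro m hm
  refine ⟨fun s => ?_, fun s => ?_⟩
  · simpa using hm.1 {s}
  · have e1 := hm.1 (univ.erase s)
    have e2 := Finset.add_sum_erase univ m (Finset.mem_univ s)
    have e3 := hm.2
    show m s ≤ p univ - p (univ.erase s)
    linarith

lemma exists_decMin [Fintype α] [DecidableEq α] (p : Finset α → ℤ) (K : ℚ) (hK : 1 < K)
    (hc : (Fintype.card α : ℚ) < K) (hne : (Bdot p).Nonempty) : ∃ m, DecMin p m := by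
  obtain ⟨m, hm, h⟩ := Set.exists_min_image (Bdot p) (Phi K) (bdot_finite p) hne
  exact ⟨m, hm, fun y hy => (decLE_iff K hK hc _ _).2 (h y hy)⟩

lemma tight_closed [DecidableEq α] (p : Finset α → ℤ) (hp : Supermodular p) (m : α → ℤ)
    (hm : ∀ X : Finset α, p X ≤ ∑ s ∈ X, m s) (X Y : Finset α)
    (hX : ∑ s ∈ X, m s = p X) (hY : ∑ s ∈ Y, m s = p Y) :
    ∑ s ∈ X ∩ Y, m s = p (X ∩ Y) ∧ ∑ s ∈ X ∪ Y, m s = p (X ∪ Y) := by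
  have e1 := hp X Y
  have e2 := Finset.sum_union_inter (s₁ := X) (s₂ := Y) (f := m)
  have e3 := hm (X ∩ Y)
  have e4 := hm (X ∪ Y)
  constructor <;> linarith

lemma peak_max [Fintype α] [DecidableEq α] (p : Finset α → ℤ) (hp : Supermodular p) (c : ℤ)
    (S₁ : Finset α)
    (hS₁ : ∀ s : α, s ∈ S₁ ↔ ∀ X : Finset α,
      (∀ Y : Finset α, p Y - c * Y.card ≤ p X - c * X.card) → s ∈ X) (Y : Finset α) :
    p Y - c * Y.card ≤ p S₁ - c * S₁.card := by
  classical
  set h : Finset α → ℤ := fun X => p X - c * X.card with hh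
  obtain ⟨M₀, hM₀⟩ := Finite.exists_max h
  obtain ⟨M, hM, hmin⟩ := Finset.exists_min_image
    (univ.filter fun X : Finset α => ∀ Y, h Y ≤ h X) Finset.card ⟨M₀, by simpa using hM₀⟩
  simp only [mem_filter, mem_univ, true_and] at hM hmin
  have : S₁ = M := by
    apply Finset.Subset.antisymm
    · intro s hs
      exact (hS₁ s).1 hs M hM
    · intro s hs
      refine (hS₁ s).2 fun X hX => ?_
      have e1 := hp M X
      have e2 : ((M ∪ X).card : ℤ) + (M ∩ X).card = M.card + X.card := by
        exact_mod_cast Finset.card_union_add_card_inter M X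
      have e3 := hM (M ∪ X)
      have e4 : h X = h M := le_antisymm (hM X) (hX M)
      have e5 : h M ≤ h (M ∩ X) := by
        have : c * ((M ∪ X).card : ℤ) + c * (M ∩ X).card = c * M.card + c * X.card := by
          rw [← mul_add, e2, mul_add]
        simp only [hh] at *
        linarith
      have e6 := hmin (M ∩ X) (fun Y => (hM Y).trans e5)
      have e7 := Finset.eq_of_subset_of_card_le (Finset.inter_subset_left (s₁ := M) (s₂ := X)) e6
      rw [← e7] at hs
      exact (Finset.mem_inter.1 hs).2
  rw [this]
  exact hM Y

lemma phi_exchange [Fintype α] [DecidableEq α] (K : ℚ) (hK : 2 ≤ K) (m : α → ℤ) (s t : α)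
    (hst : m t + 2 ≤ m s) :
    Phi K (Function.update (Function.update m s (m s - 1)) t (m t + 1)) < Phi K m := by
  have K0 : 0 < K := by linarith
  have hne : t ≠ s := by rintro rfl; omega
  unfold Phi
  rw [← Finset.add_sum_erase univ _ (mem_univ s),
    ← Finset.add_sum_erase univ (fun s => K ^ m s) (mem_univ s),
    ← Finset.add_sum_erase (univ.erase s) _ (a := t) (by simp [hne]),
    ← Finset.add_sum_erase (univ.erase s) (fun s => K ^ m s) (a := t) (by simp [hne])]
  have : ∑ x ∈ (univ.erase s).erase t,
      K ^ (Function.update (Function.update m s (m s - 1)) t (m t + 1) x) =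
      ∑ x ∈ (univ.erase s).erase t, K ^ m x := by
    apply Finset.sum_congr rfl
    intro x hx
    simp only [mem_erase, mem_univ, and_true] at hx
    rw [Function.update_of_ne hx.1, Function.update_of_ne hx.2]
  rw [this]
  simp only [Function.update_self, Function.update_of_ne hne.symm]
  have a1 : K ^ (m t + 1) ≤ K ^ (m s - 1) := zpow_le_zpow_right₀ (by linarith) (by omega)
  have a2 : K ^ (m s) = K * K ^ (m s - 1) := by
    rw [← zpow_one_add₀ K0.ne']; congr 1; ring
  have a3 : 0 < K ^ (m s - 1) := zpow_pos K0 _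
  have a4 : 0 < K ^ (m t) := zpow_pos K0 _
  have a5 : 2 * K ^ (m s - 1) ≤ K * K ^ (m s - 1) := mul_le_mul_of_nonneg_right hK a3.le
  linarith

lemma sum_exchange [DecidableEq α] (m : α → ℤ) (s t : α) (hne : t ≠ s) (X : Finset α) :
    ∑ x ∈ X, Function.update (Function.update m s (m s - 1)) t (m t + 1) x =
      ∑ x ∈ X, m x - (if s ∈ X then 1 else 0) + (if t ∈ X then 1 else 0) := by
  have : ∀ x, Function.update (Function.update m s (m s - 1)) t (m t + 1) x =
      m x - (if s = x then 1 else 0) + (if t = x then 1 else 0) := by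
    intro x
    by_cases h1 : x = t
    · subst h1; simp [hne.symm]
    · by_cases h2 : x = s
      · subst h2; simp [h1, hne]
      · simp [h1, h2, Ne.symm h1, Ne.symm h2]
  simp only [this, Finset.sum_add_distrib, Finset.sum_sub_distrib, Finset.sum_ite_eq]

lemma decMin_tight [Fintype α] [DecidableEq α] [Nonempty α]
    (p : Finset α → ℤ) (hp : Supermodular p) (h0 : p ∅ = 0) (β₁ : ℤ)
    (hβ : ∃ m ∈ Bdot p, ∀ s : α, m s ≤ β₁)
    (S₁ : Finset α)
    (hmax : ∀ Y : Finset α, p Y - (β₁ - 1) * Y.card ≤ p S₁ - (β₁ - 1) * S₁.card)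
    (m : α → ℤ) (hm : DecMin p m) : ∑ s ∈ S₁, m s = p S₁ := by
  set K : ℚ := Fintype.card α + 1 with hKd
  have hc1 : (1 : ℚ) ≤ Fintype.card α := by exact_mod_cast Fintype.card_pos
  have hK2 : 2 ≤ K := by linarith
  have hK : 1 < K := by linarith
  have K0 : 0 < K := by linarith
  have hc : (Fintype.card α : ℚ) < K := by linarith
  have hle : ∀ y ∈ Bdot p, Phi K m ≤ Phi K y := fun y hy => (decLE_iff K hK hc _ _).1 (hm.2 y hy)
  -- the upper bound
  have hub : ∀ s, m s ≤ β₁ := by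
    by_contra! hcon
    obtain ⟨s, hs⟩ := hcon
    obtain ⟨y, hy, hyb⟩ := hβ
    have e1 := hle y hy
    have e2 : Phi K y ≤ Fintype.card α * K ^ β₁ := by
      unfold Phi
      have := Finset.sum_le_card_nsmul univ (fun s => K ^ y s) (K ^ β₁)
        (fun s _ => zpow_le_zpow_right₀ hK.le (hyb s))
      rwa [nsmul_eq_mul] at this
    have e3 : K ^ m s ≤ Phi K m :=
      Finset.single_le_sum (f := fun s => K ^ m s) (fun i _ => (zpow_pos K0 _).le) (mem_univ s)
    have e4 : K * K ^ β₁ ≤ K ^ m s := by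
      rw [← zpow_one_add₀ K0.ne']
      exact zpow_le_zpow_right₀ hK.le (by omega)
    have e5 : Fintype.card α * K ^ β₁ < K * K ^ β₁ :=
      mul_lt_mul_of_pos_right hc (zpow_pos K0 _)
    linarith
  -- tight sets separating
  have hsep : ∀ s t, m t + 2 ≤ m s →
      ∃ X : Finset α, ∑ x ∈ X, m x = p X ∧ s ∈ X ∧ t ∉ X := by
    intro s t hst
    by_contra! hcon
    have hne : t ≠ s := by rintro rfl; omega
    refine absurd (hle _ ?_) (not_le.2 (phi_exchange K hK2 m s t hst))
    refine ⟨fun X => ?_, ?_⟩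
    · rw [sum_exchange m s t hne]
      have e1 := hm.1.1 X
      by_cases hs : s ∈ X <;> by_cases ht : t ∈ X <;> simp only [hs, ht, if_true, if_false]
      · linarith
      · have : ∑ x ∈ X, m x ≠ p X := fun h => ht (hcon X h hs)
        omega
      · linarith
      · linarith
    · rw [sum_exchange m s t hne]
      simp [hm.1.2]
  choose! X hXt hXs hXn using hsep
  set L := univ.filter fun t => m t + 2 ≤ β₁
  set H := univ.filter fun s => m s = β₁
  set T := H.sup fun s => L.inf fun t => X s t with hT
  have hTt : ∑ x ∈ T, m x = p T := by
    refine Finset.sup_induction (p := fun Z : Finset α => ∑ x ∈ Z, m x = p Z) ?_ ?_ ?_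
    · simp [h0]
    · intro a ha b hb
      exact (tight_closed p hp m hm.1.1 a b ha hb).2
    · intro s hs
      refine Finset.inf_induction (p := fun Z : Finset α => ∑ x ∈ Z, m x = p Z) ?_ ?_ ?_
      · exact hm.1.2
      · intro a ha b hb
        exact (tight_closed p hp m hm.1.1 a b ha hb).1
      · intro t ht
        apply hXt
        simp only [L, H, mem_filter] at hs ht
        omega
  have hTH : ∀ s, m s = β₁ → s ∈ T := by
    intro s hs
    have hsH : s ∈ H := by simp [H, hs]
    rw [hT, Finset.mem_sup]
    refine ⟨s, hsH, ?_⟩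
    rw [Finset.mem_inf]
    intro t ht
    apply hXs
    simp only [L, mem_filter] at ht
    omega
  have hTL : ∀ t ∈ T, β₁ - 1 ≤ m t := by
    intro t ht
    by_contra hcon
    rw [hT, Finset.mem_sup] at ht
    obtain ⟨s, hs, ht⟩ := ht
    rw [Finset.mem_inf] at ht
    simp only [H, mem_filter] at hs
    exact hXn s t (by omega) (ht t (by simp only [L, mem_filter, mem_univ, true_and]; omega))
  have f1 : ∀ Z : Finset α, ∑ s ∈ Z, (m s - (β₁ - 1)) = ∑ s ∈ Z, m s - (β₁ - 1) * Z.card := by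
    intro Z
    rw [Finset.sum_sub_distrib, Finset.sum_const, nsmul_eq_mul, mul_comm]
  have f2 : ∑ s ∈ S₁, (m s - (β₁ - 1)) ≤ ∑ s ∈ T, (m s - (β₁ - 1)) := by
    calc ∑ s ∈ S₁, (m s - (β₁ - 1)) ≤ ∑ s ∈ S₁ ∩ T, (m s - (β₁ - 1)) := by
          rw [← Finset.sum_inter_add_sum_sdiff S₁ T]
          have : ∑ s ∈ S₁ \ T, (m s - (β₁ - 1)) ≤ 0 := by
            apply Finset.sum_nonpos
            intro s hs
            have h1 : m s ≠ β₁ := fun h => (Finset.mem_sdiff.1 hs).2 (hTH s h)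
            have h2 := hub s
            omega
          linarith
      _ ≤ _ := by
          apply Finset.sum_le_sum_of_subset_of_nonneg Finset.inter_subset_right
          intro s hs _
          have := hTL s hs
          omega
  have f3 := hmax T
  have f4 := hm.1.1 S₁
  rw [f1, f1] at f2
  linarith

/-- Separation along the peak set `S₁`: `m` is dec-min in `Ḃ(p)` iff its restriction
to `S₁` is dec-min in `Ḃ(p₁)` and its restriction to `S ∖ S₁` is dec-min in `Ḃ(p₁′)`,
where `p₁` is the restriction of `p` to `S₁` and `p₁′(X) = p(X ∪ S₁) − p(S₁)`. -/
theorem stmt6 [Fintype α] [DecidableEq α] [Nonempty α]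
    (p : Finset α → ℤ) (hp : Supermodular p) (h0 : p ∅ = 0)
    (hne : (Bdot p).Nonempty) (β₁ : ℤ)
    (hβ : IsLeast {b : ℤ | ∃ m ∈ Bdot p, ∀ s : α, m s ≤ b} β₁)
    (S₁ : Finset α)
    (hS₁ : ∀ s : α, s ∈ S₁ ↔ ∀ X : Finset α,
      (∀ Y : Finset α, p Y - (β₁ - 1) * Y.card ≤ p X - (β₁ - 1) * X.card) → s ∈ X)
    (hproper : S₁ ⊂ Finset.univ)
    (m : α → ℤ) :
    DecMin p m ↔
      (DecMin (fun X : Finset {a : α // a ∈ S₁} =>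
          p (X.map (Function.Embedding.subtype (· ∈ S₁)))) (fun x => m x.val) ∧
       DecMin (fun X : Finset {a : α // a ∉ S₁} =>
          p ((X.map (Function.Embedding.subtype (· ∉ S₁))) ∪ S₁) - p S₁)
        (fun x => m x.val)) := by
  have hmax := peak_max p hp (β₁ - 1) S₁ hS₁
  have htight := decMin_tight p hp h0 β₁ hβ.1 S₁ hmax
  set K : ℚ := Fintype.card α + 1 with hKd
  have hc1 : (1 : ℚ) ≤ Fintype.card α := by exact_mod_cast Fintype.card_pos
  have hK : 1 < K := by linarith
  have hc : (Fintype.card α : ℚ) < K := by linarith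
  have hc₁ : (Fintype.card {a : α // a ∈ S₁} : ℚ) < K := by
    refine lt_of_le_of_lt ?_ hc
    exact_mod_cast Fintype.card_subtype_le (fun a => a ∈ S₁)
  have hc₂ : (Fintype.card {a : α // a ∉ S₁} : ℚ) < K := by
    refine lt_of_le_of_lt ?_ hc
    exact_mod_cast Fintype.card_subtype_le (fun a => a ∉ S₁)
  constructor
  · intro hm
    obtain ⟨r1, r2⟩ := bdot_restrict p S₁ m hm.1 (htight m hm)
    have glue : ∀ (y₁ : {a : α // a ∈ S₁} → ℤ) (y₂ : {a : α // a ∉ S₁} → ℤ),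
        ∃ y : α → ℤ, (fun x : {a : α // a ∈ S₁} => y x.val) = y₁ ∧
          (fun x : {a : α // a ∉ S₁} => y x.val) = y₂ := by
      intro y₁ y₂
      refine ⟨fun a => if h : a ∈ S₁ then y₁ ⟨a, h⟩ else y₂ ⟨a, h⟩, ?_, ?_⟩
      · funext x; simp [x.2]
      · funext x; simp [x.2]
    refine ⟨⟨r1, fun y₁ hy₁ => ?_⟩, ⟨r2, fun y₂ hy₂ => ?_⟩⟩
    · obtain ⟨y, e1, e2⟩ := glue y₁ (fun x => m x.val)
      have hy : y ∈ Bdot p := bdot_glue p hp S₁ y (by rw [e1]; exact hy₁) (by rw [e2]; exact r2)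
      have := (decLE_iff K hK hc _ _).1 (hm.2 y hy)
      rw [phi_split K S₁ m, phi_split K S₁ y, e1, e2] at this
      rw [decLE_iff K hK hc₁]
      linarith
    · obtain ⟨y, e1, e2⟩ := glue (fun x => m x.val) y₂
      have hy : y ∈ Bdot p := bdot_glue p hp S₁ y (by rw [e1]; exact r1) (by rw [e2]; exact hy₂)
      have := (decLE_iff K hK hc _ _).1 (hm.2 y hy)
      rw [phi_split K S₁ m, phi_split K S₁ y, e1, e2] at this
      rw [decLE_iff K hK hc₂]
      linarith
  · rintro ⟨h1, h2⟩
    refine ⟨bdot_glue p hp S₁ m h1.1 h2.1, fun y hy => ?_⟩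
    obtain ⟨z, hz⟩ := exists_decMin p K hK hc hne
    obtain ⟨r1, r2⟩ := bdot_restrict p S₁ z hz.1 (htight z hz)
    have a1 := (decLE_iff K hK hc₁ _ _).1 (h1.2 _ r1)
    have a2 := (decLE_iff K hK hc₂ _ _).1 (h2.2 _ r2)
    have a3 := (decLE_iff K hK hc _ _).1 (hz.2 y hy)
    rw [decLE_iff K hK hc]
    rw [phi_split K S₁ z] at a3
    rw [phi_split K S₁ m]
    linarith
end

section
/- Let p be an integer-valued supermodular set-function on the subsets of a nonempty finite set S with p(∅) = 0, assume Ḃ(p) is nonempty, and let F₁ be the union of all subsets X ⊆ S₁ with β₁·|X| = p₁(X). Then for an element s ∈ S₁: the value m₁(s) is the same for every decreasingly minimal element m₁ of Ḃ(p₁) (i.e., s is value-fixed) if and only if s ∈ F₁; moreover, if s ∈ F₁ then m₁(s) = β₁ for every decreasingly minimal element m₁ of Ḃ(p₁). -/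
open Finset

variable {α : Type*}

theorem aux_lex_sum (β : ℤ) {a b : List ℤ} (h : List.Lex (· < ·) a b) :
    a.Pairwise (· ≥ ·) → a.length = b.length → (∀ x ∈ b, β - 1 ≤ x ∧ x ≤ β) →
    a.sum < b.sum := by
  induction h with
  | nil => intro _ hl _; simp at hl
  | @cons x l1 l2 _ ih =>
    intro hs hl hb
    have := ih (List.pairwise_cons.1 hs).2 (by simpa using hl)
      (fun x hx => hb x (List.mem_cons_of_mem _ hx))
    simp only [List.sum_cons]
    linarith
  | @rel x l1 y l2 hxy =>
    intro hs hl hb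
    have h1 : l1.sum ≤ l1.length • x :=
      List.sum_le_card_nsmul _ _ (fun z hz => (List.pairwise_cons.1 hs).1 z hz)
    have h2 : l2.length • x ≤ l2.sum := by
      apply List.card_nsmul_le_sum
      intro z hz
      have := (hb z (List.mem_cons_of_mem _ hz)).1
      have := (hb y (by simp)).2
      omega
    have hl' : l1.length = l2.length := by simpa using hl
    rw [hl'] at h1
    simp only [List.sum_cons]
    linarith

theorem aux_sorted_pairwise {σ : Type*} [Fintype σ] (x : σ → ℤ) :
    (sortedDesc x).Pairwise (· ≥ ·) := by
  unfold sortedDesc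
  rw [List.pairwise_reverse]
  exact Multiset.pairwise_sort _ _

theorem aux_sorted_coe {σ : Type*} [Fintype σ] (x : σ → ℤ) :
    ((sortedDesc x : List ℤ) : Multiset ℤ) = Finset.univ.val.map x := by
  unfold sortedDesc
  rw [Multiset.coe_reverse, Multiset.sort_eq]

theorem aux_sorted_sum {σ : Type*} [Fintype σ] (x : σ → ℤ) :
    (sortedDesc x).sum = ∑ s, x s := by
  rw [← Multiset.sum_coe, aux_sorted_coe]; rfl

theorem aux_sorted_length {σ : Type*} [Fintype σ] (x : σ → ℤ) :
    (sortedDesc x).length = Fintype.card σ := by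
  rw [← Multiset.coe_card, aux_sorted_coe]; simp

theorem aux_sorted_mem {σ : Type*} [Fintype σ] (x : σ → ℤ) (z : ℤ) :
    z ∈ sortedDesc x ↔ ∃ s, x s = z := by
  rw [← Multiset.mem_coe, aux_sorted_coe]; simp

theorem aux_not_lex {σ : Type*} [Fintype σ] (β : ℤ) (x y : σ → ℤ)
    (hs : ∑ s, x s = ∑ s, y s) (hy : ∀ s, β - 1 ≤ y s ∧ y s ≤ β) :
    ¬ List.Lex (· < ·) (sortedDesc x) (sortedDesc y) := by
  intro h
  have := aux_lex_sum β h (aux_sorted_pairwise x)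
    (by rw [aux_sorted_length, aux_sorted_length])
    (by
      intro z hz
      obtain ⟨s, rfl⟩ := (aux_sorted_mem y z).1 hz
      exact hy s)
  rw [aux_sorted_sum, aux_sorted_sum, hs] at this
  exact lt_irrefl _ this

theorem aux_decmin {σ : Type*} [Fintype σ] (q : Finset σ → ℤ) (β : ℤ) (m₀ : σ → ℤ)
    (hm₀ : m₀ ∈ Bdot q) (hn : ∀ s, β - 1 ≤ m₀ s ∧ m₀ s ≤ β) (m : σ → ℤ) :
    DecMin q m ↔ m ∈ Bdot q ∧ ∀ s, β - 1 ≤ m s ∧ m s ≤ β := by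
  constructor
  · rintro ⟨hm, h⟩
    refine ⟨hm, fun s => ?_⟩
    rcases h m₀ hm₀ with h | h
    · have : m s ∈ sortedDesc m := (aux_sorted_mem _ _).2 ⟨s, rfl⟩
      rw [h] at this
      obtain ⟨t, ht⟩ := (aux_sorted_mem _ _).1 this
      rw [← ht]; exact hn t
    · exact absurd h (aux_not_lex β m m₀ (hm.2.trans hm₀.2.symm) hn)
  · rintro ⟨hm, h⟩
    refine ⟨hm, fun y hy => ?_⟩
    by_cases heq : sortedDesc m = sortedDesc y
    · exact Or.inl heq
    · right
      by_contra hlt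
      have h3 := aux_not_lex β y m (hy.2.trans hm.2.symm) h
      rcases lt_trichotomy (sortedDesc m) (sortedDesc y) with h4 | h4 | h4
      · exact hlt h4
      · exact heq h4
      · exact h3 h4

section
variable {σ : Type*} [Fintype σ] [DecidableEq σ]

theorem aux_card_mod (L X Y : Finset σ) :
    (L ∩ X).card + (L ∩ Y).card = (L ∩ (X ∩ Y)).card + (L ∩ (X ∪ Y)).card := by
  have := Finset.card_union_add_card_inter (L ∩ X) (L ∩ Y)
  rw [← Finset.inter_union_distrib_left, ← Finset.inter_inter_distrib_left] at this
  omega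

theorem aux_tight (h : Finset σ → ℤ) (hs : Supermodular h) (h0 : h ∅ = 0)
    (L₀ K : Finset σ) (hK : K ⊆ L₀) (hL₀ : ∀ X, h X ≤ (L₀ ∩ X).card) :
    ∃ L, K ⊆ L ∧ L ⊆ L₀ ∧ (∀ X, h X ≤ (L ∩ X).card) ∧
      ∃ U, h U = (L ∩ U).card ∧ L ⊆ U ∪ K := by
  classical
  obtain ⟨L, hL, hmin⟩ := Finset.exists_min_image
    (Finset.univ.filter (fun L : Finset σ => K ⊆ L ∧ L ⊆ L₀ ∧ ∀ X, h X ≤ (L ∩ X).card))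
    Finset.card ⟨L₀, by simp [hK, hL₀]⟩
  simp only [Finset.mem_filter, Finset.mem_univ, true_and] at hL hmin
  obtain ⟨h1, h2, h3⟩ := hL
  refine ⟨L, h1, h2, h3, ?_⟩
  -- maximal tight set
  obtain ⟨U, hU, hmax⟩ := Finset.exists_max_image
    (Finset.univ.filter (fun U : Finset σ => h U = (L ∩ U).card))
    Finset.card ⟨∅, by simp [h0]⟩
  simp only [Finset.mem_filter, Finset.mem_univ, true_and] at hU hmax
  refine ⟨U, hU, fun l hl => ?_⟩
  by_contra hn
  simp only [Finset.mem_union, not_or] at hn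
  have hex : ∃ X, (((L.erase l) ∩ X).card : ℤ) < h X := by
    by_contra hc
    push Not at hc
    have := hmin (L.erase l)
      ⟨Finset.subset_erase.2 ⟨h1, hn.2⟩, (Finset.erase_subset _ _).trans h2, hc⟩
    have := Finset.card_erase_lt_of_mem hl
    omega
  obtain ⟨X, hX⟩ := hex
  rw [Finset.erase_inter] at hX
  have hlX : l ∈ X := by
    by_contra hlX
    rw [Finset.erase_eq_of_notMem (by simp [hlX])] at hX
    exact absurd (h3 X) (not_le.2 hX)
  have hc := Finset.card_erase_add_one (Finset.mem_inter.2 ⟨hl, hlX⟩)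
  have h3X := h3 X
  have hXt : h X = (L ∩ X).card := by omega
  have hsm := hs X U
  have hm := aux_card_mod L X U
  have ha := h3 (X ∩ U)
  have hb := h3 (X ∪ U)
  have hle := hmax (X ∪ U) (by omega)
  have : U = X ∪ U := Finset.eq_of_subset_of_card_le Finset.subset_union_right hle
  exact hn.1 (this ▸ Finset.mem_union_left _ hlX)

theorem aux_exists_A (h : Finset σ → ℤ) (hs : Supermodular h) (h0 : h ∅ = 0)
    (hu : ∀ X, h X ≤ h Finset.univ)
    (L₀ : Finset σ) (hL₀ : ∀ X, h X ≤ (L₀ ∩ X).card) :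
    ∃ L, L ⊆ L₀ ∧ (∀ X, h X ≤ (L ∩ X).card) ∧ (L.card : ℤ) = h Finset.univ := by
  obtain ⟨L, -, h2, h3, U, hU, hLU⟩ := aux_tight h hs h0 L₀ ∅ (by simp) hL₀
  refine ⟨L, h2, h3, ?_⟩
  rw [Finset.union_empty] at hLU
  rw [Finset.inter_eq_left.2 hLU] at hU
  have := h3 Finset.univ
  rw [Finset.inter_univ] at this
  have := hu U
  omega

theorem aux_exists_B (h : Finset σ → ℤ) (hs : Supermodular h) (h0 : h ∅ = 0)
    (hc : ∀ X, h X ≤ X.card)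
    (hu : ∀ X, X ≠ Finset.univ → h X < h Finset.univ) (s : σ) :
    ∃ L, s ∈ L ∧ (∀ X, h X ≤ (L ∩ X).card) ∧ (L.card : ℤ) = h Finset.univ := by
  obtain ⟨L, h1, -, h3, U, hU, hLU⟩ :=
    aux_tight h hs h0 Finset.univ {s} (by simp) (by simpa using hc)
  have hsL : s ∈ L := h1 (by simp)
  refine ⟨L, hsL, h3, ?_⟩
  have h4 := h3 Finset.univ
  rw [Finset.inter_univ] at h4
  by_cases hUu : U = Finset.univ
  · subst hUu
    rw [Finset.inter_univ] at hU
    omega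
  · have h5 := hu U hUu
    have h6 : L.erase s ⊆ L ∩ U := by
      intro x hx
      have hx' := Finset.mem_erase.1 hx
      have := hLU hx'.2
      simp only [Finset.mem_union, Finset.mem_singleton] at this
      exact Finset.mem_inter.2 ⟨hx'.2, this.resolve_right hx'.1⟩
    have h7 := Finset.card_le_card h6
    have h8 := Finset.card_erase_add_one hsL
    omega

theorem aux_bdot (q : Finset σ → ℤ) (β : ℤ) (L : Finset σ)
    (hL : ∀ X : Finset σ, q X - (β - 1) * X.card ≤ (L ∩ X).card)
    (hLc : (L.card : ℤ) = q Finset.univ - (β - 1) * (Finset.univ : Finset σ).card) :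
    (fun s => β - 1 + if s ∈ L then 1 else 0) ∈ Bdot q := by
  have key : ∀ X : Finset σ, ∑ s ∈ X, (β - 1 + if s ∈ L then (1 : ℤ) else 0)
      = (β - 1) * X.card + (L ∩ X).card := by
    intro X
    rw [Finset.sum_add_distrib, Finset.sum_const, Finset.sum_boole, Finset.inter_comm,
      Finset.filter_mem_eq_inter, nsmul_eq_mul]
    ring
  refine ⟨fun X => ?_, ?_⟩
  · rw [key]; linarith [hL X]
  · rw [key, Finset.inter_univ]; linarith

theorem aux_main (q : Finset σ → ℤ) (β : ℤ) (hq : Supermodular q) (h0 : q ∅ = 0)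
    (hc : ∀ X, q X ≤ β * X.card)
    (hu : ∀ X : Finset σ, X ≠ Finset.univ → q X - (β - 1) * X.card <
      q Finset.univ - (β - 1) * (Finset.univ : Finset σ).card) (s : σ) :
    ((∀ m₁ m₂ : σ → ℤ, DecMin q m₁ → DecMin q m₂ → m₁ s = m₂ s) ↔
      ∃ X : Finset σ, β * X.card = q X ∧ s ∈ X) ∧
    ((∃ X : Finset σ, β * X.card = q X ∧ s ∈ X) → ∀ m₁ : σ → ℤ, DecMin q m₁ → m₁ s = β) := by
  obtain ⟨h, hh⟩ : ∃ h : Finset σ → ℤ, ∀ X, h X = q X - (β - 1) * X.card := ⟨_, fun _ => rfl⟩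
  have hs : Supermodular h := by
    intro X Y
    have h1 := hq X Y
    have h2 : ((X ∪ Y).card : ℤ) + (X ∩ Y).card = X.card + Y.card := by
      exact_mod_cast Finset.card_union_add_card_inter X Y
    simp only [hh]
    linear_combination h1 + (β - 1) * h2
  have hh0 : h ∅ = 0 := by simp [hh, h0]
  have hhc : ∀ X, h X ≤ X.card := by
    intro X; rw [hh]; linarith [hc X]
  have hhu : ∀ X, X ≠ Finset.univ → h X < h Finset.univ := by
    intro X hX; rw [hh, hh]; exact hu X hX
  have hhu' : ∀ X, h X ≤ h Finset.univ := by
    intro X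
    by_cases hX : X = Finset.univ
    · rw [hX]
    · exact (hhu X hX).le
  have hbd : ∀ L : Finset σ, (∀ X, h X ≤ (L ∩ X).card) → (L.card : ℤ) = h Finset.univ →
      (fun s => β - 1 + if s ∈ L then 1 else 0) ∈ Bdot q := by
    intro L hL hLc
    apply aux_bdot
    · intro X; rw [← hh]; exact hL X
    · rw [← hh]; exact hLc
  have hnu : ∀ L : Finset σ, ∀ s, β - 1 ≤ (β - 1 + if s ∈ L then 1 else 0) ∧
      (β - 1 + if s ∈ L then 1 else 0) ≤ β := by
    intro L s; split_ifs <;> constructor <;> omega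
  obtain ⟨L, hsL, hL, hLc⟩ := aux_exists_B h hs hh0 hhc hhu s
  have hdm := aux_decmin q β _ (hbd L hL hLc) (hnu L)
  have hfix : (∃ X : Finset σ, β * X.card = q X ∧ s ∈ X) →
      ∀ m₁ : σ → ℤ, DecMin q m₁ → m₁ s = β := by
    rintro ⟨X, hX, hsX⟩ m hm
    obtain ⟨hmB, hm⟩ := (hdm m).1 hm
    refine le_antisymm (hm s).2 ?_
    by_contra hlt
    push Not at hlt
    have h1 : ∑ t ∈ X, m t < ∑ _t ∈ X, β :=
      Finset.sum_lt_sum (fun t _ => (hm t).2) ⟨s, hsX, hlt⟩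
    have h2 := hmB.1 X
    rw [Finset.sum_const, nsmul_eq_mul] at h1
    linarith
  refine ⟨⟨fun hall => ?_, fun hX m₁ m₂ h1 h2 => (hfix hX m₁ h1).trans (hfix hX m₂ h2).symm⟩, hfix⟩
  by_contra hnX
  push Not at hnX
  obtain ⟨L', hsub, hL', hLc'⟩ := aux_exists_A h hs hh0 hhu' (Finset.univ.erase s) (by
    intro X
    rw [Finset.erase_inter, Finset.univ_inter]
    by_cases hsX : s ∈ X
    · have h1 := Finset.card_erase_add_one hsX
      have h2 : h X ≠ X.card := by
        intro h2
        refine hnX X ?_ hsX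
        rw [hh] at h2
        linarith
      have h3 := hhc X
      omega
    · rw [Finset.erase_eq_of_notMem hsX]; exact hhc X)
  have hsL' : s ∉ L' := fun hmem => by simpa using hsub hmem
  have := hall _ _ ((hdm _).2 ⟨hbd L hL hLc, hnu L⟩) ((hdm _).2 ⟨hbd L' hL' hLc', hnu L'⟩)
  simp [hsL, hsL'] at this
  omega

theorem aux_peak (h : Finset σ → ℤ) (hs : Supermodular h) (S₁ : Finset σ)
    (hS₁ : ∀ s, s ∈ S₁ ↔ ∀ X : Finset σ, (∀ Y, h Y ≤ h X) → s ∈ X) :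
    ∀ X, X ⊂ S₁ → h X < h S₁ := by
  classical
  obtain ⟨X₀, -, hX₀⟩ := Finset.exists_max_image (Finset.univ : Finset (Finset σ)) h ⟨∅, by simp⟩
  obtain ⟨M, hM, hmin⟩ := Finset.exists_min_image
    (Finset.univ.filter (fun X : Finset σ => ∀ Y, h Y ≤ h X))
    Finset.card ⟨X₀, by simpa using hX₀⟩
  simp only [Finset.mem_filter, Finset.mem_univ, true_and] at hM hmin
  have hMS : S₁ = M := by
    ext s
    rw [hS₁]
    refine ⟨fun hX => hX M hM, fun hsM X hX => ?_⟩
    have h1 := hs X M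
    have h2 := hM (X ∪ M)
    have h4 : ∀ Y, h Y ≤ h (X ∩ M) := fun Y => by linarith [hX Y]
    have h5 := hmin _ h4
    have h6 := Finset.eq_of_subset_of_card_le Finset.inter_subset_right h5
    rw [← h6] at hsM
    exact (Finset.mem_inter.1 hsM).1
  intro X hX
  by_contra hc
  push Not at hc
  have h7 : ∀ Y, h Y ≤ h X := fun Y => by
    have := hM Y
    rw [← hMS] at this
    exact this.trans hc
  exact hX.2 (fun s hsS => (hS₁ s).1 hsS X h7)

end

/-- Value-fixed elements of the peak set `S₁`: `s ∈ S₁` is value-fixed (all dec-min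
elements of `Ḃ(p₁)` agree at `s`) iff `s` lies in `F₁`, the union of all `X ⊆ S₁`
with `β₁·|X| = p₁(X)`; moreover every dec-min element takes the value `β₁` there. -/
theorem stmt8 [Fintype α] [DecidableEq α] [Nonempty α]
    (p : Finset α → ℤ) (hp : Supermodular p) (h0 : p ∅ = 0)
    (hne : (Bdot p).Nonempty) (β₁ : ℤ)
    (hβ : IsLeast {b : ℤ | ∃ m ∈ Bdot p, ∀ s : α, m s ≤ b} β₁)
    (S₁ : Finset α)
    (hS₁ : ∀ s : α, s ∈ S₁ ↔ ∀ X : Finset α,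
      (∀ Y : Finset α, p Y - (β₁ - 1) * Y.card ≤ p X - (β₁ - 1) * X.card) → s ∈ X) :
    ∀ s : {a : α // a ∈ S₁},
      ((∀ m₁ m₂ : {a : α // a ∈ S₁} → ℤ,
          DecMin (fun X : Finset {a : α // a ∈ S₁} =>
            p (X.map (Function.Embedding.subtype (· ∈ S₁)))) m₁ →
          DecMin (fun X : Finset {a : α // a ∈ S₁} =>
            p (X.map (Function.Embedding.subtype (· ∈ S₁)))) m₂ →
          m₁ s = m₂ s) ↔
        (∃ X : Finset {a : α // a ∈ S₁},
          β₁ * X.card = p (X.map (Function.Embedding.subtype (· ∈ S₁))) ∧ s ∈ X)) ∧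
      ((∃ X : Finset {a : α // a ∈ S₁},
          β₁ * X.card = p (X.map (Function.Embedding.subtype (· ∈ S₁))) ∧ s ∈ X) →
        ∀ m₁ : {a : α // a ∈ S₁} → ℤ,
          DecMin (fun X : Finset {a : α // a ∈ S₁} =>
            p (X.map (Function.Embedding.subtype (· ∈ S₁)))) m₁ → m₁ s = β₁) := by
  intro s
  have hpk := aux_peak (fun X => p X - (β₁ - 1) * X.card) (by
    intro X Y
    have h1 := hp X Y
    have h2 : ((X ∪ Y).card : ℤ) + (X ∩ Y).card = X.card + Y.card := by
      exact_mod_cast Finset.card_union_add_card_inter X Y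
    linear_combination h1 + (β₁ - 1) * h2) S₁ hS₁
  obtain ⟨m, hm, hmb⟩ := hβ.1
  refine aux_main (fun X : Finset {a : α // a ∈ S₁} =>
            p (X.map (Function.Embedding.subtype (· ∈ S₁)))) β₁ ?_ ?_ ?_ ?_ s
  · intro X Y
    have := hp (X.map (Function.Embedding.subtype (· ∈ S₁)))
      (Y.map (Function.Embedding.subtype (· ∈ S₁)))
    rw [← Finset.map_inter, ← Finset.map_union] at this
    exact this
  · simpa using h0
  · intro X
    have h1 := hm.1 (X.map (Function.Embedding.subtype (· ∈ S₁)))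
    have h2 := Finset.sum_le_card_nsmul (X.map (Function.Embedding.subtype (· ∈ S₁))) m β₁
      (fun t _ => hmb t)
    rw [Finset.card_map, nsmul_eq_mul] at h2
    show p _ ≤ _
    linarith
  · intro X hX
    have hun : (Finset.univ : Finset {a : α // a ∈ S₁}).map
        (Function.Embedding.subtype (· ∈ S₁)) = S₁ := by
      ext a; simp
    have hss : X.map (Function.Embedding.subtype (· ∈ S₁)) ⊂ S₁ := by
      have h1 : X ⊂ Finset.univ := Finset.ssubset_univ_iff.2 hX
      have h2 := (Finset.map_ssubset_map (f := Function.Embedding.subtype (· ∈ S₁))).2 h1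
      rwa [hun] at h2
    have h3 := hpk _ hss
    have h4 : (Finset.univ : Finset {a : α // a ∈ S₁}).card = S₁.card := by simp
    simp only [Finset.card_map] at h3
    rw [h4]
    simp only [hun]
    exact h3
end
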